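/- arXiv:2311.11443 — 2 statements merged into one kernel-verified Lean document; each statement's English description precedes it below -/
import Mathlib

section
/- Let N = (P,T,F,g,ℳ0) be a high-level Petri net with symbolic unfolding Υ = (U, π), where U has events E. For every configuration C of Υ, every instantiation ι ∈ I(C), every transition t ∈ T, and every mode σ of t: the transition t can fire in mode σ from the marking Mark(C,ι) if and only if there exists an event e ∈ E with π(e) = t such that e can fire in mode σ from the cut Cut(C,ι). -/
/-
Core formalization of high-level Petri nets, symbolic unfoldings,
branching processes, configurations, adequate orders, cut-off events,
expansions and constraints, following Würdemann–Chatain–Haar–Panneke,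
"Taking Complete Finite Prefixes To High Level, Symbolically".
-/

noncomputable section
open scoped Classical

/-- A high-level Petri net over a set `Color` of colors and a set `Var` of variables:
places, transitions, a flow function (given by the multisets of `(place, variable)`
pairs on the input resp. output arcs of each transition), a guard for each transition
(a predicate on the assignments of colors to variables), and a set of initial markings. -/
structure HLNet (Color : Type) (Var : Type) : Type 1 where
  Place : Type
  Trans : Type
  preFlow : Trans → Multiset (Place × Var)
  postFlow : Trans → Multiset (Place × Var)
  guard : Trans → (Var → Color) → Prop
  init : Set (Multiset (Place × Color))

namespace HLNet

variable {Color Var : Type}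

/-- A marking: a multiset over `Place × Color`. -/
abbrev Marking (N : HLNet Color Var) : Type := Multiset (N.Place × Color)

/-- Well-formedness: the set of initial markings is nonempty, and all initial markings
mark the same places with the same numbers of colors. -/
def WellFormed (N : HLNet Color Var) : Prop :=
  N.init.Nonempty ∧
    ∀ M ∈ N.init, ∀ M' ∈ N.init, Multiset.map Prod.fst M = Multiset.map Prod.fst M'

/-- The net is finite: finitely many places and transitions
(the support of the flow function is then automatically finite). -/
def NetFinite (N : HLNet Color Var) : Prop := Finite N.Place ∧ Finite N.Trans

/-- The guards are written in a decidable theory (stand-in: each guard is a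
decidable predicate on modes). -/
def DecidableGuards (N : HLNet Color Var) : Prop :=
  ∀ t σ, Nonempty (Decidable (N.guard t σ))

/-- `•(t,σ)`, the multiset of colored tokens consumed by transition `t` fired in mode `σ`. -/
def preMark (N : HLNet Color Var) (t : N.Trans) (σ : Var → Color) : N.Marking :=
  (N.preFlow t).map fun pv => (pv.1, σ pv.2)

/-- `(t,σ)•`, the multiset of colored tokens produced by transition `t` fired in mode `σ`. -/
def postMark (N : HLNet Color Var) (t : N.Trans) (σ : Var → Color) : N.Marking :=
  (N.postFlow t).map fun pv => (pv.1, σ pv.2)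

/-- `M[t,σ⟩`: transition `t` can fire in mode `σ` from marking `M`
(`σ` is a mode of `t`, i.e. the guard holds, and `•(t,σ) ≤ M`). -/
def fires (N : HLNet Color Var) (M : N.Marking) (t : N.Trans) (σ : Var → Color) : Prop :=
  N.guard t σ ∧ N.preMark t σ ≤ M

/-- `M[t,σ⟩M'`: firing `t` in mode `σ` from `M` yields `M'`. -/
def firesTo (N : HLNet Color Var) (M : N.Marking) (t : N.Trans) (σ : Var → Color)
    (M' : N.Marking) : Prop :=
  N.fires M t σ ∧ M' = (M - N.preMark t σ) + N.postMark t σ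

/-- `R(N)`: the markings reachable from some initial marking by finitely many firings. -/
inductive Reach (N : HLNet Color Var) : N.Marking → Prop
  | init {M : N.Marking} : M ∈ N.init → Reach N M
  | step {M : N.Marking} {t : N.Trans} {σ : Var → Color} {M' : N.Marking} :
      Reach N M → N.firesTo M t σ M' → Reach N M'

/-- The markings reachable in exactly `n` firings. -/
def ReachSteps (N : HLNet Color Var) : ℕ → N.Marking → Prop
  | 0, M => M ∈ N.init
  | n + 1, M' => ∃ M t σ, ReachSteps N n M ∧ N.firesTo M t σ M'

/-- Every reachable marking is reachable by firing at most `n` transitions. -/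
def BoundedReach (N : HLNet Color Var) (n : ℕ) : Prop :=
  ∀ M, N.Reach M → ∃ k ≤ n, N.ReachSteps k M

/-- Safety: in every reachable marking every place holds at most one color. -/
def Safe (N : HLNet Color Var) : Prop :=
  ∀ M, N.Reach M → ∀ p : N.Place, (M.filter fun pc => pc.1 = p).card ≤ 1

/-- Nodes of the net: places and transitions. -/
abbrev Node (N : HLNet Color Var) : Type := N.Place ⊕ N.Trans

/-- The arc relation `x → y` between nodes. -/
def arc (N : HLNet Color Var) : N.Node → N.Node → Prop
  | Sum.inl b, Sum.inr t => ∃ v, (b, v) ∈ N.preFlow t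
  | Sum.inr t, Sum.inl b => ∃ v, (b, v) ∈ N.postFlow t
  | Sum.inl _, Sum.inl _ => False
  | Sum.inr _, Sum.inr _ => False

/-- The causality relation `<` (irreflexive transitive closure of the arc relation). -/
def clt (N : HLNet Color Var) : N.Node → N.Node → Prop := Relation.TransGen N.arc

/-- The causality relation `≤` (reflexive transitive closure of the arc relation). -/
def cle (N : HLNet Color Var) : N.Node → N.Node → Prop := Relation.ReflTransGen N.arc

/-- `<` on transitions/events. -/
def evLT (N : HLNet Color Var) (e e' : N.Trans) : Prop := N.clt (Sum.inr e) (Sum.inr e')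

/-- `≤` on transitions/events. -/
def evLE (N : HLNet Color Var) (e e' : N.Trans) : Prop := N.cle (Sum.inr e) (Sum.inr e')

/-- Structural conflict `x ♯ y`: distinct transitions sharing an input place
causally precede `x` and `y` respectively. -/
def SConflict (N : HLNet Color Var) (x y : N.Node) : Prop :=
  ∃ (b : N.Place) (t1 t2 : N.Trans), t1 ≠ t2 ∧
    (∃ v, (b, v) ∈ N.preFlow t1) ∧ (∃ v, (b, v) ∈ N.preFlow t2) ∧
    N.cle (Sum.inr t1) x ∧ N.cle (Sum.inr t2) y

/-- Ordinariness: at most one arc connects any two nodes. -/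
def Ordinary (N : HLNet Color Var) : Prop :=
  (∀ (t : N.Trans) (b : N.Place), ((N.preFlow t).filter fun pv => pv.1 = b).card ≤ 1) ∧
  (∀ (t : N.Trans) (b : N.Place), ((N.postFlow t).filter fun pv => pv.1 = b).card ≤ 1)

/-- A high-level occurrence net: an ordinary well-formed high-level Petri net
(places = conditions, transitions = events) such that no event is in structural
self-conflict, no node is its own causal predecessor, causality is well-founded,
and each condition either has no incoming arc and is marked with exactly one color
in all initial cuts, or has a unique incoming arc and is unmarked in all initial cuts. -/
def IsOccNet (O : HLNet Color Var) : Prop :=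
  O.WellFormed ∧ O.Ordinary ∧
  (∀ e : O.Trans, ¬ O.SConflict (Sum.inr e) (Sum.inr e)) ∧
  (∀ x : O.Node, ¬ O.clt x x) ∧
  WellFounded O.clt ∧
  (∀ b : O.Place,
    ((∀ (e : O.Trans) (v : Var), (b, v) ∉ O.postFlow e) ∧
      ∀ K ∈ O.init, (K.filter fun bc => bc.1 = b).card = 1) ∨
    ((∃ (e : O.Trans) (v : Var), (b, v) ∈ O.postFlow e ∧
        ∀ (e' : O.Trans) (v' : Var), (b, v') ∈ O.postFlow e' → e' = e ∧ v' = v) ∧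
      ∀ K ∈ O.init, (K.filter fun bc => bc.1 = b).card = 0))

/-- `•b = (e(b), v(b))`: the unique input event and arc-variable of a condition,
or `none` for the `⊥`-conditions (the conditions marked in all initial cuts). -/
def condPre (O : HLNet Color Var) (b : O.Place) : Option (O.Trans × Var) :=
  if h : ∃ ev : O.Trans × Var, (b, ev.2) ∈ O.postFlow ev.1 then some h.choose else none

/-- An assignment of colors to the indexed variables: the variables `v_e` for events `e`
(`Sum.inl (e, v)`), and the variables `v^b_⊥` for conditions `b` (`Sum.inr b`). -/
abbrev Assign (O : HLNet Color Var) : Type := ((O.Trans × Var) ⊕ O.Place) → Color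

/-- The color placed on condition `b` under assignment `ι`:
the value of `v(b)_{e(b)}`, resp. `v^b_⊥`. -/
def valOf (O : HLNet Color Var) (ι : O.Assign) (b : O.Place) : Color :=
  match O.condPre b with
  | none => ι (Sum.inr b)
  | some ev => ι (Sum.inl ev)

/-- `pred(⊥)`: `ι` chooses one of the initial cuts. -/
def predBot (O : HLNet Color Var) (ι : O.Assign) : Prop :=
  ∃ K ∈ O.init, ∀ (b : O.Place) (c : Color), (b, c) ∈ K → ι (Sum.inr b) = c

/-- `loc(e)`: the local predicate of an event. -/
def locPred (O : HLNet Color Var) (e : O.Trans) (ι : O.Assign) : Prop :=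
  O.guard e (fun v => ι (Sum.inl (e, v))) ∧
  ∀ bv ∈ O.preFlow e, ι (Sum.inl (e, bv.2)) = O.valOf ι bv.1

/-- `pred(e) = pred(⊥) ∧ ⋀_{e' ≤ e} loc(e')`. -/
def pred (O : HLNet Color Var) (e : O.Trans) (ι : O.Assign) : Prop :=
  O.predBot ι ∧ ∀ e', O.evLE e' e → O.locPred e' ι

/-- `pred(e(b))` for a condition `b` (which is `pred(⊥)` for `⊥`-conditions). -/
def condPred (O : HLNet Color Var) (b : O.Place) (ι : O.Assign) : Prop :=
  match O.condPre b with
  | none => O.predBot ι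
  | some ev => O.pred ev.1 ι

/-- An instantiation of a set `C` of events: an assignment satisfying `pred(e)` for
every `e ∈ C ∪ {⊥}`. -/
def IsInst (O : HLNet Color Var) (C : Set O.Trans) (ι : O.Assign) : Prop :=
  O.predBot ι ∧ ∀ e ∈ C, O.pred e ι

/-- A configuration: a causally closed set of events free of structural conflict
and of color conflict. -/
def IsConfig (O : HLNet Color Var) (C : Set O.Trans) : Prop :=
  (∀ e ∈ C, ∀ e', O.evLE e' e → e' ∈ C) ∧
  (∀ e ∈ C, ∀ e' ∈ C, ¬ O.SConflict (Sum.inr e) (Sum.inr e')) ∧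
  ∃ ι, O.IsInst C ι

/-- A finite configuration. -/
def FinCfg (O : HLNet Color Var) (C : Set O.Trans) : Prop := O.IsConfig C ∧ C.Finite

/-- The cone configuration `[e] = {e' : e' ≤ e}` of an event. -/
def cone (O : HLNet Color Var) (e : O.Trans) : Set O.Trans := {e' | O.evLE e' e}

/-- `B0`: the conditions marked in all initial cuts (those with `•b = (⊥, v^b)`). -/
def B0 (O : HLNet Color Var) : Set O.Place := {b | O.condPre b = none}

/-- `C→`: the conditions in the postsets of the events of `C`. -/
def postConds (O : HLNet Color Var) (C : Set O.Trans) : Set O.Place :=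
  {b | ∃ e ∈ C, ∃ v, (b, v) ∈ O.postFlow e}

/-- `→C`: the conditions in the presets of the events of `C`. -/
def preConds (O : HLNet Color Var) (C : Set O.Trans) : Set O.Place :=
  {b | ∃ e ∈ C, ∃ v, (b, v) ∈ O.preFlow e}

/-- `Cut(C) = (B0 ∪ C→) \ →C`. -/
def cut (O : HLNet Color Var) (C : Set O.Trans) : Set O.Place :=
  (O.B0 ∪ O.postConds C) \ O.preConds C

/-- `Cut(C, ι)` as a marking of the occurrence net (requires `Cut(C)` to be finite). -/
def cutMark (O : HLNet Color Var) {C : Set O.Trans} (hfin : (O.cut C).Finite)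
    (ι : O.Assign) : O.Marking :=
  hfin.toFinset.val.map fun b => (b, O.valOf ι b)

/-- `Cut(C, ι) = {(b, ι(v(b)_{e(b)})) : b ∈ Cut(C)}` as a set. -/
def cutSet (O : HLNet Color Var) (C : Set O.Trans) (ι : O.Assign) : Set (O.Place × Color) :=
  {bc | bc.1 ∈ O.cut C ∧ bc.2 = O.valOf ι bc.1}

/-- `Cuts(C) = {Cut(C,ι) : ι ∈ I(C)}`. -/
def cuts (O : HLNet Color Var) (C : Set O.Trans) : Set (Set (O.Place × Color)) :=
  {K | ∃ ι, O.IsInst C ι ∧ K = O.cutSet C ι}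

/-- `Cuts(C)` as a set of markings of the occurrence net. -/
def cutMarks (O : HLNet Color Var) (C : Set O.Trans) : Set O.Marking :=
  {K | ∃ ι, O.IsInst C ι ∧ ∃ hfin : (O.cut C).Finite, K = O.cutMark hfin ι}

/-- A homomorphism of high-level nets: maps places to places and transitions to
transitions, preserving guards and the presets and postsets of transitions. -/
structure Hom (O N : HLNet Color Var) where
  mapP : O.Place → N.Place
  mapT : O.Trans → N.Trans
  guard_iff : ∀ (e : O.Trans) (σ : Var → Color), O.guard e σ ↔ N.guard (mapT e) σ
  pre_eq : ∀ e : O.Trans, N.preFlow (mapT e) = (O.preFlow e).map fun bv => (mapP bv.1, bv.2)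
  post_eq : ∀ e : O.Trans, N.postFlow (mapT e) = (O.postFlow e).map fun bv => (mapP bv.1, bv.2)

/-- The image of a marking under a homomorphism. -/
def Hom.mapMarking {O N : HLNet Color Var} (φ : Hom O N) (M : O.Marking) : N.Marking :=
  M.map fun bc => (φ.mapP bc.1, bc.2)

/-- An initial homomorphism: it maps the initial markings onto the initial markings. -/
def Hom.Initial {O N : HLNet Color Var} (φ : Hom O N) : Prop :=
  φ.mapMarking '' O.init = N.init

/-- `Mark(C, ι)`: the marking of `N` represented by the cut of an instantiated
configuration. -/
def mark {O N : HLNet Color Var} (h : Hom O N) {C : Set O.Trans}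
    (hfin : (O.cut C).Finite) (ι : O.Assign) : N.Marking :=
  hfin.toFinset.val.map fun b => (h.mapP b, O.valOf ι b)

/-- `Marks(C) = {Mark(C,ι) : ι ∈ I(C)}`. -/
def marks {O N : HLNet Color Var} (h : Hom O N) (C : Set O.Trans) : Set N.Marking :=
  {M | ∃ ι, O.IsInst C ι ∧ ∃ hfin : (O.cut C).Finite, M = mark h hfin ι}

/-- `(O, h)` is a symbolic branching process of `N`: `O` is an occurrence net all of
whose event predicates are satisfiable, and `h` is an initial homomorphism that is
injective on events with the same preset. -/
def IsSBP {O N : HLNet Color Var} (h : Hom O N) : Prop :=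
  O.IsOccNet ∧ h.Initial ∧ (∀ e : O.Trans, ∃ ι, O.pred e ι) ∧
  ∀ e e' : O.Trans, O.preFlow e = O.preFlow e' → h.mapT e = h.mapT e' → e = e'

/-- `(O1, h1)` is a prefix of `(O2, h2)`: there is an injective initial homomorphism
`φ : O1 → O2` with `h2 ∘ φ = h1`. -/
def IsPrefix {O1 O2 N : HLNet Color Var} (h1 : Hom O1 N) (h2 : Hom O2 N) : Prop :=
  ∃ φ : Hom O1 O2, φ.Initial ∧ Function.Injective φ.mapP ∧ Function.Injective φ.mapT ∧
    (∀ b, h2.mapP (φ.mapP b) = h1.mapP b) ∧ ∀ e, h2.mapT (φ.mapT e) = h1.mapT e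

/-- `(O, h)` is the symbolic unfolding `Υ(N)` of `N`: the (unique up to isomorphism)
maximal symbolic branching process of `N`. -/
def IsUnfolding {O N : HLNet Color Var} (h : Hom O N) : Prop :=
  IsSBP h ∧ ∀ (O' : HLNet Color Var) (h' : Hom O' N), IsSBP h' → IsPrefix h' h

/-- The net `N` with its set of initial markings replaced by `I`. -/
def withInit (N : HLNet Color Var) (I : Set N.Marking) : HLNet Color Var :=
  { N with init := I }

/-- Restriction of a marking to a subset of the places. -/
def restrictMark (O : HLNet Color Var) (SP : Set O.Place) (M : O.Marking) :
    Multiset (↥SP × Color) :=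
  M.filterMap fun bc => if h : bc.1 ∈ SP then some (⟨bc.1, h⟩, bc.2) else none

/-- The subnet of `O` on the places `SP` and transitions `ST`, with initial markings `I`. -/
def restrict (O : HLNet Color Var) (SP : Set O.Place) (ST : Set O.Trans)
    (I : Set (Multiset (↥SP × Color))) : HLNet Color Var where
  Place := ↥SP
  Trans := ↥ST
  preFlow e := (O.preFlow e.1).filterMap fun bv =>
    if h : bv.1 ∈ SP then some (⟨bv.1, h⟩, bv.2) else none
  postFlow e := (O.postFlow e.1).filterMap fun bv =>
    if h : bv.1 ∈ SP then some (⟨bv.1, h⟩, bv.2) else none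
  guard e σ := O.guard e.1 σ
  init := I

/-- The predicate contributed by a node to a color conflict:
`pred(e)` for an event `e`, `pred(e(b))` for a condition `b`. -/
def nodePred (O : HLNet Color Var) (x : O.Node) (ι : O.Assign) : Prop :=
  match x with
  | Sum.inl b => O.condPred b ι
  | Sum.inr e => O.pred e ι

/-- The nodes of the future `↑C`: nodes not in `C ∪ →C`, not in structural conflict
with any event of `C`, and not in color conflict together with `C`. -/
def futureNode (O : HLNet Color Var) (C : Set O.Trans) (x : O.Node) : Prop :=
  (match x with
   | Sum.inl b => b ∉ O.preConds C
   | Sum.inr e => e ∉ C) ∧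
  (∀ e' ∈ C, ¬ O.SConflict (Sum.inr e') x) ∧
  ∃ ι, O.IsInst C ι ∧ O.nodePred x ι

def futurePlaces (O : HLNet Color Var) (C : Set O.Trans) : Set O.Place :=
  {b | O.futureNode C (Sum.inl b)}

def futureEvents (O : HLNet Color Var) (C : Set O.Trans) : Set O.Trans :=
  {e | O.futureNode C (Sum.inr e)}

/-- The underlying net of the future `↑C` of a configuration `C`, with the cuts of `C`
as initial cuts. -/
def future (O : HLNet Color Var) (C : Set O.Trans) : HLNet Color Var :=
  O.restrict (O.futurePlaces C) (O.futureEvents C)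
    (O.restrictMark (O.futurePlaces C) '' O.cutMarks C)

def futPVal (O : HLNet Color Var) (C : Set O.Trans) : (O.future C).Place → O.Place :=
  fun b => b.1

def futTVal (O : HLNet Color Var) (C : Set O.Trans) : (O.future C).Trans → O.Trans :=
  fun e => e.1

/-- The conditions of the occurrence net `O(C|D)`: `Cut(C) ∪ →D ∪ D→`. -/
def aroundPlaces (O : HLNet Color Var) (C D : Set O.Trans) : Set O.Place :=
  O.cut C ∪ O.preConds D ∪ O.postConds D

/-- The occurrence net `O(C|D)` "around `D` from `Cut(C)`", with initial cuts `Cuts(C)`. -/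
def around (O : HLNet Color Var) (C D : Set O.Trans) : HLNet Color Var :=
  O.restrict (O.aroundPlaces C D) D
    (O.restrictMark (O.aroundPlaces C D) '' O.cutMarks C)

def arPVal (O : HLNet Color Var) (C D : Set O.Trans) : (O.around C D).Place → O.Place :=
  fun b => b.1

def arTVal (O : HLNet Color Var) (C D : Set O.Trans) : (O.around C D).Trans → O.Trans :=
  fun e => e.1

/-- `D` is a suffix of `C`, i.e. `C ⊕ D` is defined: `C` and `D` are disjoint and
`C ∪ D` is a configuration. -/
def IsSuffix (O : HLNet Color Var) (C D : Set O.Trans) : Prop :=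
  Disjoint C D ∧ O.IsConfig (C ∪ D)

/-- `C⟦M⟧D`: some instantiation of `C ⊕ D`, restricted to the variables of `C ∪ {⊥}`,
yields the marking `M` for `C`. -/
def markRel {O N : HLNet Color Var} (h : Hom O N) (C : Set O.Trans) (M : N.Marking)
    (D : Set O.Trans) : Prop :=
  ∃ ι, O.IsInst (C ∪ D) ι ∧ ∃ hfin : (O.cut C).Finite, mark h hfin ι = M

/-- `φ` is a monomorphism `O(C1|D) → ↑C2` preserving the labeling and mapping
`Cut(C1)` onto `Cut(C2)`. -/
def IsCanonMono {O N : HLNet Color Var} (h : Hom O N) (C1 D C2 : Set O.Trans)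
    (φ : Hom (O.around C1 D) (O.future C2)) : Prop :=
  Function.Injective φ.mapP ∧ Function.Injective φ.mapT ∧
  (∀ b, h.mapP (O.futPVal C2 (φ.mapP b)) = h.mapP (O.arPVal C1 D b)) ∧
  (∀ e, h.mapT (O.futTVal C2 (φ.mapT e)) = h.mapT (O.arTVal C1 D e)) ∧
  (fun b => O.futPVal C2 (φ.mapP b)) '' {b | O.arPVal C1 D b ∈ O.cut C1} = O.cut C2

/-- `φ(D)`: the image of the events `D` of `O(C1|D)` under `φ`, as a set of events of `O`. -/
def monoImageD {O : HLNet Color Var} (C1 D C2 : Set O.Trans)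
    (φ : Hom (O.around C1 D) (O.future C2)) : Set O.Trans :=
  {e | ∃ d, O.futTVal C2 (φ.mapT d) = e}

/-- An adequate order on the finite configurations of a symbolic branching process
`(O, h)`: a well-founded strict partial order refining set inclusion and preserved
by finite extensions (via the canonical monomorphism between the futures). -/
def IsAdequate {O N : HLNet Color Var} (h : Hom O N)
    (r : Set O.Trans → Set O.Trans → Prop) : Prop :=
  (∀ C, O.FinCfg C → ¬ r C C) ∧
  (∀ C1 C2 C3, O.FinCfg C1 → O.FinCfg C2 → O.FinCfg C3 → r C1 C2 → r C2 C3 → r C1 C3) ∧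
  WellFounded (fun a b : {C : Set O.Trans // O.FinCfg C} => r a.1 b.1) ∧
  (∀ C1 C2, O.FinCfg C1 → O.FinCfg C2 → C1 ⊂ C2 → r C1 C2) ∧
  (∀ C1 C2 D M, O.FinCfg C1 → O.FinCfg C2 → O.IsSuffix C1 D → D.Finite →
    M ∈ marks h C1 → M ∈ marks h C2 → markRel h C1 M D →
    ∀ φ : Hom (O.around C1 D) (O.future C2), IsCanonMono h C1 D C2 φ →
      r C1 C2 → r (C1 ∪ D) (C2 ∪ monoImageD C1 D C2 φ))

/-- A cut-off event: every marking of its cone configuration is represented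
by the cone configuration of a `≺`-smaller event. -/
def IsCutoff {O N : HLNet Color Var} (h : Hom O N)
    (r : Set O.Trans → Set O.Trans → Prop) (e : O.Trans) : Prop :=
  ∀ M ∈ marks h (O.cone e), ∃ e', r (O.cone e') (O.cone e) ∧ M ∈ marks h (O.cone e')

/-- A cut-off* event: every marking of its cone configuration is represented
by some `≺`-smaller finite configuration. -/
def IsCutoffStar {O N : HLNet Color Var} (h : Hom O N)
    (r : Set O.Trans → Set O.Trans → Prop) (e : O.Trans) : Prop :=
  ∀ M ∈ marks h (O.cone e), ∃ C, O.FinCfg C ∧ r C (O.cone e) ∧ M ∈ marks h C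

/-- The events of the prefix `Fin`: events whose cone contains no cut-off event other
than possibly the event itself. -/
def finEvents {O N : HLNet Color Var} (h : Hom O N)
    (r : Set O.Trans → Set O.Trans → Prop) : Set O.Trans :=
  {e | ∀ e' ∈ O.cone e, e' ≠ e → ¬ IsCutoff h r e'}

/-- The conditions of the prefix `Fin`: the conditions of `B0` and those in the
postsets of the events of `Fin`. -/
def finConds {O N : HLNet Color Var} (h : Hom O N)
    (r : Set O.Trans → Set O.Trans → Prop) : Set O.Place :=
  O.B0 ∪ {b | ∃ e ∈ finEvents h r, ∃ v, (b, v) ∈ O.postFlow e}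

/-- The events of the prefix `Fin` for the cut-off* criterion. -/
def finEventsStar {O N : HLNet Color Var} (h : Hom O N)
    (r : Set O.Trans → Set O.Trans → Prop) : Set O.Trans :=
  {e | ∀ e' ∈ O.cone e, e' ≠ e → ¬ IsCutoffStar h r e'}

/-- The conditions of the prefix `Fin` for the cut-off* criterion. -/
def finCondsStar {O N : HLNet Color Var} (h : Hom O N)
    (r : Set O.Trans → Set O.Trans → Prop) : Set O.Place :=
  O.B0 ∪ {b | ∃ e ∈ finEventsStar h r, ∃ v, (b, v) ∈ O.postFlow e}

/-- Completeness of the sub-branching-process of `(O,h)` on the events `E'`: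
every reachable marking `M` of `N` is `Mark(C,ι)` for a configuration `C ⊆ E'` and
an instantiation `ι ∈ I(C)` such that moreover every transition/mode firable from `M`
is matched by an event of `E'` firable from `Cut(C,ι)`. -/
def CompleteSub {O N : HLNet Color Var} (h : Hom O N) (E' : Set O.Trans) : Prop :=
  ∀ M, N.Reach M → ∃ C, O.IsConfig C ∧ C ⊆ E' ∧ ∃ ι, O.IsInst C ι ∧
    ∃ hfin : (O.cut C).Finite, M = mark h hfin ι ∧
      ∀ (t : N.Trans) (σ : Var → Color), N.fires M t σ →
        ∃ e ∈ E', h.mapT e = t ∧ O.fires (O.cutMark hfin ι) e σ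

/-- Completeness of the branching process `(O, h)`. -/
def Complete {O N : HLNet Color Var} (h : Hom O N) : Prop := CompleteSub h Set.univ

/-- The class `Nf`: finite safe high-level Petri nets with decidable guards and
finitely many reachable markings. -/
def InNf (N : HLNet Color Var) : Prop :=
  N.NetFinite ∧ N.WellFormed ∧ N.Safe ∧ N.DecidableGuards ∧ {M | N.Reach M}.Finite

/-- The class `Nsc` of symbolically compact nets: finite safe high-level Petri nets
with decidable guards admitting a bound on the number of transition firings needed
to reach every reachable marking. -/
def InNsc (N : HLNet Color Var) : Prop :=
  N.NetFinite ∧ N.WellFormed ∧ N.Safe ∧ N.DecidableGuards ∧ ∃ n, N.BoundedReach n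

/-- The modes of a transition. -/
def Mode (N : HLNet Color Var) (t : N.Trans) : Type := {σ : Var → Color // N.guard t σ}

/-- The expansion `Exp(N)`: the P/T Petri net (a high-level net over the trivial sets
of colors and variables) with places `p.c` and transitions `t.σ`. -/
def expand (N : HLNet Color Var) : HLNet Unit Unit where
  Place := N.Place × Color
  Trans := (t : N.Trans) × N.Mode t
  preFlow tσ := (N.preMark tσ.1 tσ.2.1).map fun pc => (pc, ())
  postFlow tσ := (N.postMark tσ.1 tσ.2.1).map fun pc => (pc, ())
  guard _ _ := True
  init := (fun M : N.Marking => M.map fun pc => (pc, ())) '' N.init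

def expPlaceBase (N : HLNet Color Var) : N.expand.Place → N.Place := fun pc => pc.1
def expPlaceColor (N : HLNet Color Var) : N.expand.Place → Color := fun pc => pc.2
def expTransBase (N : HLNet Color Var) : N.expand.Trans → N.Trans := fun tσ => tσ.1
def expTransMode (N : HLNet Color Var) (tσ : N.expand.Trans) : Var → Color := tσ.2.1

/-- The constraint `constr(B')` on a co-set `B'` of conditions, evaluated on an
assignment `a` of colors to the labels `π(B')` (predb(b) for all `b ∈ B'`,
with all bound indexed variables existentially quantified at once). -/
def constrSat {O N : HLNet Color Var} (h : Hom O N) (B' : Set O.Place)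
    (a : N.Place → Color) : Prop :=
  ∃ ι : O.Assign, ∀ b ∈ B', O.condPred b ι ∧ a (h.mapP b) = O.valOf ι b

/-- `φ(E')`: the multiset of the transition labels of a finite set of events. -/
def labelMS {O N : HLNet Color Var} (h : Hom O N) (S : Set O.Trans) : Multiset N.Trans :=
  if hfin : S.Finite then hfin.toFinset.val.map h.mapT else 0

/-- Lexicographic comparison of the `≪`-sorted sequences of two multisets. -/
def msLex {α : Type} (lo : LinearOrder α) (s1 s2 : Multiset α) : Prop :=
  letI := lo
  List.Lex (· < ·) (s1.sort (· ≤ ·)) (s2.sort (· ≤ ·))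

/-- `Min(S)`: the causally minimal events of `S`. -/
def minOf (O : HLNet Color Var) (S : Set O.Trans) : Set O.Trans :=
  {e | e ∈ S ∧ ∀ e' ∈ S, ¬ O.evLT e' e}

/-- What remains of `C` after removing the first `n` blocks of its Foata normal form. -/
def foataResidual (O : HLNet Color Var) (C : Set O.Trans) : ℕ → Set O.Trans
  | 0 => C
  | n + 1 => foataResidual O C n \ O.minOf (foataResidual O C n)

/-- The `n`-th block of the Foata normal form of `C`. -/
def foataBlock (O : HLNet Color Var) (C : Set O.Trans) (n : ℕ) : Set O.Trans :=
  O.minOf (O.foataResidual C n)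

/-- `FC1 ≪ FC2`: comparison of Foata normal forms. -/
def foataLex {O N : HLNet Color Var} (h : Hom O N) (lo : LinearOrder N.Trans)
    (C1 C2 : Set O.Trans) : Prop :=
  ∃ i : ℕ, (∀ j < i, labelMS h (O.foataBlock C1 j) = labelMS h (O.foataBlock C2 j)) ∧
    msLex lo (labelMS h (O.foataBlock C1 i)) (labelMS h (O.foataBlock C2 i))

/-- McMillan's order `≺_M`: comparison by size. -/
def rM {O : HLNet Color Var} (C1 C2 : Set O.Trans) : Prop := C1.ncard < C2.ncard

/-- The order `≺_E`: by size, then lexicographically on sorted label sequences. -/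
def rE {O N : HLNet Color Var} (h : Hom O N) (lo : LinearOrder N.Trans)
    (C1 C2 : Set O.Trans) : Prop :=
  C1.ncard < C2.ncard ∨
    (C1.ncard = C2.ncard ∧ msLex lo (labelMS h C1) (labelMS h C2))

/-- The total order `≺_F`: by size, then lexicographically on sorted label sequences,
then by Foata normal forms. -/
def rF {O N : HLNet Color Var} (h : Hom O N) (lo : LinearOrder N.Trans)
    (C1 C2 : Set O.Trans) : Prop :=
  C1.ncard < C2.ncard ∨
    (C1.ncard = C2.ncard ∧ msLex lo (labelMS h C1) (labelMS h C2)) ∨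
    (labelMS h C1 = labelMS h C2 ∧ foataLex h lo C1 C2)

end HLNet

theorem Multiset.exists_matching_of_map_le_map {α β γ : Type*} {f : α → γ} {g : β → γ}
    {s : Multiset α} {t : Multiset β} (h : s.map f ≤ t.map g) :
    ∃ P : Multiset (α × β), P.map Prod.fst = s ∧ P.map Prod.snd ≤ t ∧
      ∀ p ∈ P, f p.1 = g p.2 := by
  induction s using Multiset.induction_on generalizing t with
  | empty => exact ⟨0, by simp⟩
  | cons a s ih =>
    rw [Multiset.map_cons] at h
    obtain ⟨b, hb, hab⟩ := Multiset.mem_map.1 (Multiset.mem_of_le h (Multiset.mem_cons_self _ _))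
    obtain ⟨t, rfl⟩ := Multiset.exists_cons_of_mem hb
    rw [Multiset.map_cons, hab, Multiset.cons_le_cons_iff] at h
    obtain ⟨P, hs, ht, hP⟩ := ih h
    refine ⟨(a, b) ::ₘ P, by simp [hs], by simpa using ht, fun p hp => ?_⟩
    rcases Multiset.mem_cons.1 hp with rfl | hp
    · exact hab.symm
    · exact hP p hp

theorem Function.mem_periodicPts_of_injective_of_mapsTo {α : Type*} {f : α → α}
    (hf : Function.Injective f) {s : Set α} (hs : s.Finite) (hfs : Set.MapsTo f s s) {x : α}
    (hx : x ∈ s) : x ∈ Function.periodicPts f := by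
  have : Finite s := hs
  have hinj : Function.Injective (hfs.restrict f s s) := fun a b h =>
    Subtype.ext (hf (congrArg Subtype.val h))
  have hmem : (⟨x, hx⟩ : s) ∈ Function.periodicPts (hfs.restrict f s s) := by
    rw [Function.injective_iff_periodicPts_eq_univ.1 hinj]
    trivial
  obtain ⟨n, hn, hp⟩ := hmem
  refine ⟨n, hn, ?_⟩
  have := congrArg Subtype.val (show _ = _ from hp)
  rwa [hfs.iterate_restrict n] at this

theorem Function.exists_common_period {α β : Type*} {f : α → α} (s : Multiset β) (g : β → α)
    (h : ∀ b ∈ s, g b ∈ Function.periodicPts f) :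
    ∃ n > 0, ∀ b ∈ s, f^[n] (g b) = g b := by
  induction s using Multiset.induction_on with
  | empty => exact ⟨1, by simp⟩
  | cons a s ih =>
    obtain ⟨n, hn, hs⟩ := ih fun b hb => h b (Multiset.mem_cons_of_mem hb)
    obtain ⟨m, hm, ha⟩ := h a (Multiset.mem_cons_self _ _)
    refine ⟨m * n, Nat.mul_pos hm hn, fun b hb => ?_⟩
    rcases Multiset.mem_cons.1 hb with rfl | hb
    · exact ha.mul_const n
    · exact Function.IsPeriodicPt.const_mul (hs b hb) m

theorem Multiset.inl_mem_map_prodMap_inl {α β γ : Type*} {M : Multiset (α × γ)} {a : α} {c : γ} :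
    ((Sum.inl a, c) : (α ⊕ β) × γ) ∈ M.map (Prod.map Sum.inl id) ↔ (a, c) ∈ M := by
  simp

theorem Multiset.inr_notMem_map_prodMap_inl {α β γ : Type*} {M : Multiset (α × γ)} {b : β}
    {c : γ} : ((Sum.inr b, c) : (α ⊕ β) × γ) ∉ M.map (Prod.map Sum.inl id) := by
  simp

theorem Multiset.card_filter_map_prodMap_inl {α β γ : Type*} (M : Multiset (α × γ)) (a : α)
    {_ : DecidablePred fun x : (α ⊕ β) × γ => x.1 = Sum.inl a}
    {_ : DecidablePred fun x : α × γ => x.1 = a} :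
    ((M.map (Prod.map (Sum.inl : α → α ⊕ β) id)).filter fun x => x.1 = Sum.inl a).card =
      (M.filter fun x => x.1 = a).card := by
  simp [Multiset.filter_map]

theorem Multiset.card_filter_map_prodMap_inl_inr {α β γ : Type*} (M : Multiset (α × γ)) (b : β)
    {_ : DecidablePred fun x : (α ⊕ β) × γ => x.1 = Sum.inr b} :
    ((M.map (Prod.map (Sum.inl : α → α ⊕ β) id)).filter fun x => x.1 = Sum.inr b).card = 0 := by
  simp [Multiset.filter_map]

theorem Multiset.card_filter_map_univ_inr_le_one {α β γ : Type*} [Fintype β] (w : β → γ)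
    (x : α ⊕ β) {_ : DecidablePred fun y : (α ⊕ β) × γ => y.1 = x} :
    (((Finset.univ : Finset β).val.map fun i => ((Sum.inr i : α ⊕ β), w i)).filter
      fun y => y.1 = x).card ≤ 1 := by
  rw [Multiset.filter_map, Multiset.card_map, ← Finset.filter_val, Finset.card_val,
    Finset.card_le_one]
  intro i hi j hj
  exact Sum.inr_injective ((Finset.mem_filter.1 hi).2.trans (Finset.mem_filter.1 hj).2.symm)

theorem Multiset.map_eq_map_map {α β γ : Type*} {f : β → γ} {g : α → β} {h : α → γ}
    {s : Multiset α} (hfg : ∀ a, f (g a) = h a) : s.map h = (s.map g).map f := by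
  rw [Multiset.map_map]
  exact Multiset.map_congr rfl fun a _ => (hfg a).symm

namespace HLNet

variable {Color Var : Type}

/-! ### Occurrence nets -/

theorem condPre_eq_some {O : HLNet Color Var} (hO : O.IsOccNet) {b : O.Place} {e : O.Trans}
    {v : Var} (h : (b, v) ∈ O.postFlow e) : O.condPre b = some (e, v) := by
  have hex : ∃ ev : O.Trans × Var, (b, ev.2) ∈ O.postFlow ev.1 := ⟨(e, v), h⟩
  rw [condPre, dif_pos hex]
  have hspec := hex.choose_spec
  obtain ⟨_, _, _, _, _, hb⟩ := hO
  rcases hb b with ⟨hnone, _⟩ | ⟨⟨e₀, v₀, _, huniq⟩, _⟩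
  · exact absurd h (hnone e v)
  · obtain ⟨h1, h2⟩ := huniq _ _ hspec
    obtain ⟨h3, h4⟩ := huniq _ _ h
    exact congrArg some (Prod.ext (h1.trans h3.symm) (h2.trans h4.symm))

theorem condPre_eq_none {O : HLNet Color Var} {b : O.Place}
    (h : ∀ e v, (b, v) ∉ O.postFlow e) : O.condPre b = none :=
  dif_neg fun ⟨ev, hev⟩ => h ev.1 ev.2 hev

theorem not_mem_postFlow_of_mem_B0 {O : HLNet Color Var} {b : O.Place} (h : b ∈ O.B0)
    (e : O.Trans) (v : Var) : (b, v) ∉ O.postFlow e := fun hb => by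
  have hex : ∃ ev : O.Trans × Var, (b, ev.2) ∈ O.postFlow ev.1 := ⟨(e, v), hb⟩
  have h' : O.condPre b = none := h
  rw [condPre, dif_pos hex] at h'
  cases h'

theorem exists_postFlow_of_cle {O : HLNet Color Var} {e : O.Trans} {b : O.Place}
    (h : O.cle (Sum.inr e) (Sum.inl b)) : ∃ e' v, (b, v) ∈ O.postFlow e' ∧ O.evLE e e' := by
  obtain h | ⟨y, hy, hyb⟩ := Relation.ReflTransGen.cases_tail h
  · cases h
  · rcases y with b' | e'
    · exact hyb.elim
    · obtain ⟨v, hv⟩ := hyb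
      exact ⟨e', v, hv, hy⟩

/-- The events causally below a condition of `Cut(C)` belong to `C`. -/
theorem mem_of_cle_cut {O : HLNet Color Var} (hO : O.IsOccNet) {C : Set O.Trans}
    (hC : O.IsConfig C) {b : O.Place} (hb : b ∈ O.cut C) {e : O.Trans}
    (h : O.cle (Sum.inr e) (Sum.inl b)) : e ∈ C := by
  obtain ⟨e', v, hv, hle⟩ := exists_postFlow_of_cle h
  rcases hb.1 with hB | ⟨e₂, he₂, v₂, hv₂⟩
  · exact absurd hv (not_mem_postFlow_of_mem_B0 hB e' v)
  · have := (condPre_eq_some hO hv).symm.trans (condPre_eq_some hO hv₂)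
    simp only [Option.some.injEq, Prod.mk.injEq] at this
    exact hC.1 e₂ he₂ e (this.1 ▸ hle)

/-! ### Homomorphisms -/

/-- Composition of homomorphisms. -/
def Hom.comp {A B D : HLNet Color Var} (g : Hom B D) (f : Hom A B) : Hom A D where
  mapP := g.mapP ∘ f.mapP
  mapT := g.mapT ∘ f.mapT
  guard_iff e σ := (f.guard_iff e σ).trans (g.guard_iff _ σ)
  pre_eq e := by simp [g.pre_eq, f.pre_eq, Multiset.map_map]
  post_eq e := by simp [g.post_eq, f.post_eq, Multiset.map_map]

theorem Hom.Initial.comp {A B D : HLNet Color Var} {g : Hom B D} {f : Hom A B}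
    (hg : g.Initial) (hf : f.Initial) : (g.comp f).Initial := by
  have : (g.comp f).mapMarking = g.mapMarking ∘ f.mapMarking := by
    funext M
    simp [Hom.mapMarking, Hom.comp, Multiset.map_map]
  rw [Hom.Initial, this, Set.image_comp, hf, hg]

theorem Hom.preFlow_iterate {O : HLNet Color Var} (ψ : Hom O O) (n : ℕ) (e : O.Trans) :
    O.preFlow (ψ.mapT^[n] e) = (O.preFlow e).map fun bv => (ψ.mapP^[n] bv.1, bv.2) := by
  induction n generalizing e with
  | zero => simp
  | succ n ih => simp [ih, ψ.pre_eq, Multiset.map_map]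

theorem Hom.postFlow_iterate {O : HLNet Color Var} (ψ : Hom O O) (n : ℕ) (e : O.Trans) :
    O.postFlow (ψ.mapT^[n] e) = (O.postFlow e).map fun bv => (ψ.mapP^[n] bv.1, bv.2) := by
  induction n generalizing e with
  | zero => simp
  | succ n ih => simp [ih, ψ.post_eq, Multiset.map_map]

/-- Every condition is a periodic point of an injective initial endomorphism of a symbolic
branching process. -/
theorem mem_periodicPts_of_endomorphism {O N : HLNet Color Var} {h : Hom O N} (hO : IsSBP h)
    {ψ : Hom O O} (hψ : ψ.Initial) (hinj : Function.Injective ψ.mapP)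
    (hT : ∀ e, h.mapT (ψ.mapT e) = h.mapT e) (b : O.Place) :
    b ∈ Function.periodicPts ψ.mapP := by
  obtain ⟨⟨⟨⟨K, hK⟩, hsame⟩, _, _, _, hwf, hcond⟩, _, _, hevinj⟩ := hO
  have key : ∀ x : O.Node, ∀ b, x = Sum.inl b → b ∈ Function.periodicPts ψ.mapP := by
    intro x
    induction x using hwf.induction with
    | h x ih =>
    rintro b rfl
    rcases hcond b with ⟨_, hinit⟩ | ⟨⟨e, v, hev, _⟩, _⟩
    · have hcard := hinit K hK
      obtain ⟨bc, hbc⟩ := Multiset.card_pos_iff_exists_mem.1 (hcard ▸ Nat.one_pos)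
      rw [Multiset.mem_filter] at hbc
      have hb : b ∈ K.map Prod.fst := Multiset.mem_map.2 ⟨bc, hbc⟩
      refine Function.mem_periodicPts_of_injective_of_mapsTo (s := {b | b ∈ K.map Prod.fst})
        hinj (K.map Prod.fst).finite_toSet ?_ hb
      intro a ha
      have hmem : ψ.mapMarking K ∈ O.init := hψ ▸ Set.mem_image_of_mem _ hK
      have heq := hsame _ hmem _ hK
      rw [Set.mem_ofPred_eq, ← heq]
      obtain ⟨ac, hac, rfl⟩ := Multiset.mem_map.1 ha
      simp only [Hom.mapMarking, Multiset.map_map]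
      exact Multiset.mem_map.2 ⟨ac, hac, rfl⟩
    · have harc : O.arc (Sum.inr e) (Sum.inl b) := ⟨v, hev⟩
      obtain ⟨n, hn, hfix⟩ := Function.exists_common_period (f := ψ.mapP) (O.preFlow e) Prod.fst
        fun bv hbv => ih (Sum.inl bv.1)
          ((Relation.TransGen.single (show O.arc (Sum.inl bv.1) (Sum.inr e) from
            ⟨bv.2, hbv⟩)).tail harc) _ rfl
      have he : ψ.mapT^[n] e = e := by
        refine hevinj _ _ ?_ ?_
        · rw [ψ.preFlow_iterate]
          conv_rhs => rw [← Multiset.map_id (O.preFlow e)]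
          exact Multiset.map_congr rfl fun bv hbv => Prod.ext (hfix bv hbv) rfl
        · have : ∀ m e, h.mapT (ψ.mapT^[m] e) = h.mapT e := by
            intro m
            induction m with
            | zero => simp
            | succ m ihm => intro e; rw [Function.iterate_succ_apply, ihm, hT]
          exact this n e
      have hper : b ∈ Function.periodicPts (ψ.mapP^[n]) := by
        refine Function.mem_periodicPts_of_injective_of_mapsTo
          (s := {b | b ∈ (O.postFlow e).map Prod.fst}) (hinj.iterate n)
          (Multiset.finite_toSet _) ?_ (Multiset.mem_map.2 ⟨_, hev, rfl⟩)
        intro a ha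
        obtain ⟨av, hav, rfl⟩ := Multiset.mem_map.1 ha
        rw [Set.mem_ofPred_eq, ← he, ψ.postFlow_iterate, Multiset.map_map]
        exact Multiset.mem_map.2 ⟨av, hav, rfl⟩
      obtain ⟨m, hm, hfixm⟩ := hper
      refine ⟨n * m, Nat.mul_pos hn hm, ?_⟩
      rw [Function.IsPeriodicPt, Function.iterate_mul]
      exact hfixm
  exact key _ b rfl

/-! ### Adding an event to a net -/

/-- The net `O` extended by one event (`none`) with preset `Q` and guard `g`, whose postset
consists of new conditions indexed by `I`, the arc to condition `i` being labeled `w i`. -/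
def addEvent (O : HLNet Color Var) (Q : Multiset (O.Place × Var)) (g : (Var → Color) → Prop)
    {I : Type} [Fintype I] (w : I → Var) : HLNet Color Var where
  Place := O.Place ⊕ I
  Trans := Option O.Trans
  preFlow e := ((e.elim Q O.preFlow).map (Prod.map Sum.inl id) : Multiset ((O.Place ⊕ I) × Var))
  postFlow e := e.elim ((Finset.univ : Finset I).val.map fun i => (Sum.inr i, w i))
    fun e => (O.postFlow e).map (Prod.map Sum.inl id)
  guard e := e.elim g O.guard
  init := (fun K => K.map (Prod.map Sum.inl id)) '' O.init

section AddEvent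

variable {O : HLNet Color Var} {Q : Multiset (O.Place × Var)} {g : (Var → Color) → Prop}
  {I : Type} [Fintype I] {w : I → Var}

/-- The inclusion of `O` into `O.addEvent Q g w`. -/
def addEventIncl (O : HLNet Color Var) (Q : Multiset (O.Place × Var)) (g : (Var → Color) → Prop)
    {I : Type} [Fintype I] (w : I → Var) : Hom O (O.addEvent Q g w) where
  mapP := Sum.inl
  mapT := some
  guard_iff _ _ := Iff.rfl
  pre_eq _ := rfl
  post_eq _ := rfl

theorem addEventIncl_initial : (addEventIncl O Q g w).Initial := rfl

theorem inl_mem_preFlow_none {b : O.Place} {v : Var} :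
    ((Sum.inl b, v) : (O.Place ⊕ I) × Var) ∈ (O.addEvent Q g w).preFlow none ↔ (b, v) ∈ Q :=
  Multiset.inl_mem_map_prodMap_inl

theorem inl_mem_preFlow_some {b : O.Place} {v : Var} {e : O.Trans} :
    ((Sum.inl b, v) : (O.Place ⊕ I) × Var) ∈ (O.addEvent Q g w).preFlow (some e) ↔
      (b, v) ∈ O.preFlow e :=
  Multiset.inl_mem_map_prodMap_inl

theorem inr_not_mem_preFlow {i : I} {v : Var} {e : Option O.Trans} :
    ((Sum.inr i, v) : (O.Place ⊕ I) × Var) ∉ (O.addEvent Q g w).preFlow e :=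
  Multiset.inr_notMem_map_prodMap_inl

theorem inl_not_mem_postFlow_none {b : O.Place} {v : Var} :
    ((Sum.inl b, v) : (O.Place ⊕ I) × Var) ∉ (O.addEvent Q g w).postFlow none := by
  change _ ∉ (Finset.univ : Finset I).val.map fun i => ((Sum.inr i : O.Place ⊕ I), w i)
  simp

theorem inl_mem_postFlow_some {b : O.Place} {v : Var} {e : O.Trans} :
    ((Sum.inl b, v) : (O.Place ⊕ I) × Var) ∈ (O.addEvent Q g w).postFlow (some e) ↔
      (b, v) ∈ O.postFlow e :=
  Multiset.inl_mem_map_prodMap_inl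

theorem inr_mem_postFlow_none {i : I} {v : Var} :
    ((Sum.inr i, v) : (O.Place ⊕ I) × Var) ∈ (O.addEvent Q g w).postFlow none ↔ v = w i := by
  change _ ∈ (Finset.univ : Finset I).val.map (fun i => ((Sum.inr i : O.Place ⊕ I), w i)) ↔ _
  simp [eq_comm]

theorem inr_not_mem_postFlow_some {i : I} {v : Var} {e : O.Trans} :
    ((Sum.inr i, v) : (O.Place ⊕ I) × Var) ∉ (O.addEvent Q g w).postFlow (some e) :=
  Multiset.inr_notMem_map_prodMap_inl

/-- The inclusion of the nodes of `O` into those of `O.addEvent Q g w`. -/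
def addEventNode (Q : Multiset (O.Place × Var)) (g : (Var → Color) → Prop) (w : I → Var) :
    O.Node → (O.addEvent Q g w).Node :=
  Sum.map (addEventIncl O Q g w).mapP (addEventIncl O Q g w).mapT

theorem arc_addEventNode {x : O.Node} {y : (O.addEvent Q g w).Node}
    (h : (O.addEvent Q g w).arc y (addEventNode Q g w x)) :
    ∃ y', y = addEventNode Q g w y' ∧ O.arc y' x := by
  rcases x with b | e <;> rcases y with (b' | i) | (_ | e')
  · exact h.elim
  · exact h.elim
  · obtain ⟨v, hv⟩ := h
    exact absurd hv inl_not_mem_postFlow_none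
  · obtain ⟨v, hv⟩ := h
    exact ⟨Sum.inr e', rfl, v, inl_mem_postFlow_some.1 hv⟩
  · obtain ⟨v, hv⟩ := h
    exact ⟨Sum.inl b', rfl, v, inl_mem_preFlow_some.1 hv⟩
  · obtain ⟨v, hv⟩ := h
    exact absurd hv inr_not_mem_preFlow
  · exact h.elim
  · exact h.elim

theorem cle_addEventNode {x : O.Node} {y : (O.addEvent Q g w).Node}
    (h : (O.addEvent Q g w).cle y (addEventNode Q g w x)) :
    ∃ y', y = addEventNode Q g w y' ∧ O.cle y' x := by
  induction h using Relation.ReflTransGen.head_induction_on with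
  | refl => exact ⟨x, rfl, .refl⟩
  | head hac _ ih =>
    obtain ⟨c', rfl, hc⟩ := ih
    obtain ⟨a', rfl, ha⟩ := arc_addEventNode hac
    exact ⟨a', rfl, hc.head ha⟩

theorem evLE_some {e : O.Trans} {e' : (O.addEvent Q g w).Trans}
    (h : (O.addEvent Q g w).evLE e' (some e)) : ∃ e₀, e' = some e₀ ∧ O.evLE e₀ e := by
  obtain ⟨y | y, hy, hle⟩ := cle_addEventNode (x := Sum.inr e) h
  · cases hy
  · exact ⟨y, Sum.inr_injective hy, hle⟩

theorem evLE_none {e' : (O.addEvent Q g w).Trans}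
    (h : (O.addEvent Q g w).evLE e' none) :
    e' = none ∨ ∃ e₀, e' = some e₀ ∧ ∃ bv ∈ Q, O.cle (Sum.inr e₀) (Sum.inl bv.1) := by
  obtain h | ⟨y, hy, hyn⟩ := Relation.ReflTransGen.cases_tail h
  · exact Or.inl (Sum.inr_injective h).symm
  · right
    rcases y with (b | i) | e
    · obtain ⟨v, hv⟩ := hyn
      obtain ⟨z | z, hz, hle⟩ := cle_addEventNode (x := Sum.inl b) hy
      · cases hz
      · exact ⟨z, Sum.inr_injective hz, (b, v), inl_mem_preFlow_none.1 hv, hle⟩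
    · obtain ⟨v, hv⟩ := hyn
      exact absurd hv inr_not_mem_preFlow
    · exact hyn.elim

theorem wellFounded_arc_addEvent (hwf : WellFounded O.arc) :
    WellFounded (O.addEvent Q g w).arc := by
  have hold : ∀ x, Acc (O.addEvent Q g w).arc (addEventNode Q g w x) := by
    intro x
    induction x using hwf.induction with
    | h x ih =>
    refine ⟨_, fun y hy => ?_⟩
    obtain ⟨y', rfl, hy'⟩ := arc_addEventNode hy
    exact ih y' hy'
  have hnone : Acc (O.addEvent Q g w).arc (Sum.inr none) := by
    refine ⟨_, fun y hy => ?_⟩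
    rcases y with (b | i) | e
    · exact hold (Sum.inl b)
    · obtain ⟨v, hv⟩ := hy
      exact absurd hv inr_not_mem_preFlow
    · exact hy.elim
  refine ⟨fun x => ?_⟩
  rcases x with (b | i) | (_ | e)
  · exact hold (Sum.inl b)
  · refine ⟨_, fun y hy => ?_⟩
    rcases y with b | (_ | e)
    · exact hy.elim
    · exact hnone
    · exact hold (Sum.inr e)
  · exact hnone
  · exact hold (Sum.inr e)

theorem ordinary_addEvent (hO : O.Ordinary)
    (hQ : ∀ b, (Q.filter fun bv => bv.1 = b).card ≤ 1) : (O.addEvent Q g w).Ordinary := by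
  refine ⟨?_, ?_⟩
  · rintro (_ | e) (b | i)
    · exact (Multiset.card_filter_map_prodMap_inl Q b).trans_le (hQ b)
    · exact (Multiset.card_filter_map_prodMap_inl_inr Q i).trans_le zero_le_one
    · exact (Multiset.card_filter_map_prodMap_inl _ b).trans_le (hO.1 e b)
    · exact (Multiset.card_filter_map_prodMap_inl_inr _ i).trans_le zero_le_one
  · rintro (_ | e) (b | i)
    · exact Multiset.card_filter_map_univ_inr_le_one w (Sum.inl b)
    · exact Multiset.card_filter_map_univ_inr_le_one w (Sum.inr i)
    · exact (Multiset.card_filter_map_prodMap_inl _ b).trans_le (hO.2 e b)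
    · exact (Multiset.card_filter_map_prodMap_inl_inr _ i).trans_le zero_le_one

theorem wellFormed_addEvent (hO : O.WellFormed) : (O.addEvent Q g w).WellFormed := by
  refine ⟨hO.1.image _, ?_⟩
  rintro _ ⟨M, hM, rfl⟩ _ ⟨M', hM', rfl⟩
  have hfst : ∀ K : O.Marking, (K.map Prod.fst).map (Sum.inl : O.Place → O.Place ⊕ I) =
      (K.map (Prod.map Sum.inl id)).map Prod.fst := fun K => by
    simp only [Multiset.map_map, Function.comp_def, Prod.map_fst]
  exact (hfst M).symm.trans ((congrArg _ (hO.2 M hM M' hM')).trans (hfst M'))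

theorem isOccNet_addEvent (hO : O.IsOccNet) {C : Set O.Trans} (hC : O.IsConfig C)
    (hcut : ∀ bv ∈ Q, bv.1 ∈ O.cut C) (hQ : ∀ b, (Q.filter fun bv => bv.1 = b).card ≤ 1) :
    (O.addEvent Q g w).IsOccNet := by
  have hmem : ∀ {e₀ : O.Trans}, (∃ bv ∈ Q, O.cle (Sum.inr e₀) (Sum.inl bv.1)) → e₀ ∈ C :=
    fun ⟨bv, hbv, hle⟩ => mem_of_cle_cut hO hC (hcut bv hbv) hle
  have hO' := hO
  obtain ⟨hWF, hord, hself, _, hwf, hcond⟩ := hO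
  have hwf' : WellFounded (O.addEvent Q g w).clt :=
    (wellFounded_arc_addEvent (Subrelation.wf (fun h => Relation.TransGen.single h) hwf)).transGen
  refine ⟨wellFormed_addEvent hWF, ordinary_addEvent hord hQ, ?_,
    fun x hx => hwf'.irrefl.irrefl x hx, hwf', ?_⟩
  · rintro (_ | e) ⟨b, t1, t2, hne, ⟨v1, h1⟩, ⟨v2, h2⟩, hle1, hle2⟩
    · rcases b with b | i
      swap
      · exact inr_not_mem_preFlow h1
      rcases evLE_none hle1 with rfl | ⟨e1, rfl, hc1⟩ <;>
        rcases evLE_none hle2 with rfl | ⟨e2, rfl, hc2⟩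
      · exact hne rfl
      · exact (hcut _ (inl_mem_preFlow_none.1 h1)).2
          ⟨e2, hmem hc2, v2, inl_mem_preFlow_some.1 h2⟩
      · exact (hcut _ (inl_mem_preFlow_none.1 h2)).2
          ⟨e1, hmem hc1, v1, inl_mem_preFlow_some.1 h1⟩
      · exact hC.2.1 e1 (hmem hc1) e2 (hmem hc2) ⟨b, e1, e2, fun h => hne (congrArg some h),
          ⟨v1, inl_mem_preFlow_some.1 h1⟩, ⟨v2, inl_mem_preFlow_some.1 h2⟩, .refl, .refl⟩
    · rcases b with b | i
      swap
      · exact inr_not_mem_preFlow h1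
      obtain ⟨e1, rfl, hc1⟩ := evLE_some hle1
      obtain ⟨e2, rfl, hc2⟩ := evLE_some hle2
      exact hself e ⟨b, e1, e2, fun h => hne (congrArg some h),
        ⟨v1, inl_mem_preFlow_some.1 h1⟩, ⟨v2, inl_mem_preFlow_some.1 h2⟩, hc1, hc2⟩
  · rintro (b | i)
    · rcases hcond b with ⟨hno, hinit⟩ | ⟨⟨e, v, hev, huniq⟩, hinit⟩
      · left
        refine ⟨?_, ?_⟩
        · rintro (_ | e) v
          · exact inl_not_mem_postFlow_none
          · exact fun h => hno e v (inl_mem_postFlow_some.1 h)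
        · rintro _ ⟨K, hK, rfl⟩
          exact (Multiset.card_filter_map_prodMap_inl K b).trans (hinit K hK)
      · right
        refine ⟨⟨some e, v, inl_mem_postFlow_some.2 hev, ?_⟩, ?_⟩
        · rintro (_ | e') v' h
          · exact absurd h inl_not_mem_postFlow_none
          · exact (huniq e' v' (inl_mem_postFlow_some.1 h)).imp_left (congrArg some)
        · rintro _ ⟨K, hK, rfl⟩
          exact (Multiset.card_filter_map_prodMap_inl K b).trans (hinit K hK)
    · right
      refine ⟨⟨none, w i, inr_mem_postFlow_none.2 rfl, ?_⟩, ?_⟩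
      · rintro (_ | e') v' h
        · exact ⟨rfl, inr_mem_postFlow_none.1 h⟩
        · exact absurd h inr_not_mem_postFlow_some
      · rintro _ ⟨K, hK, rfl⟩
        exact Multiset.card_filter_map_prodMap_inl_inr K i

/-- The extension of an assignment of `O` to `O.addEvent Q g w` by a mode of the new event. -/
def extendAssign (Q : Multiset (O.Place × Var)) (g : (Var → Color) → Prop) (w : I → Var)
    (σ : Var → Color) (ι : O.Assign) : (O.addEvent Q g w).Assign
  | Sum.inl (none, v) => σ v
  | Sum.inl (some e, v) => ι (Sum.inl (e, v))
  | Sum.inr (Sum.inl b) => ι (Sum.inr b)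
  | Sum.inr (Sum.inr i) => σ (w i)

theorem valOf_extendAssign (hO : O.IsOccNet) (hO' : (O.addEvent Q g w).IsOccNet)
    (σ : Var → Color) (ι : O.Assign) (b : O.Place) :
    (O.addEvent Q g w).valOf (extendAssign Q g w σ ι) (Sum.inl b) = O.valOf ι b := by
  by_cases h : ∃ e v, (b, v) ∈ O.postFlow e
  · obtain ⟨e, v, hev⟩ := h
    have h' : (O.addEvent Q g w).condPre (Sum.inl b) = some (some e, v) :=
      condPre_eq_some hO' (inl_mem_postFlow_some.2 hev)
    simp only [valOf, condPre_eq_some hO hev, h', extendAssign]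
  · push Not at h
    have h' : (O.addEvent Q g w).condPre (Sum.inl b) = none := by
      apply condPre_eq_none
      rintro (_ | e) v
      · exact inl_not_mem_postFlow_none
      · exact fun hb => h e v (inl_mem_postFlow_some.1 hb)
    simp only [valOf, condPre_eq_none h, h', extendAssign]

theorem predBot_extendAssign {σ : Var → Color} {ι : O.Assign} (h : O.predBot ι) :
    (O.addEvent Q g w).predBot (extendAssign Q g w σ ι) := by
  obtain ⟨K, hK, hval⟩ := h
  refine ⟨_, ⟨K, hK, rfl⟩, ?_⟩
  rintro b c hbc
  obtain ⟨⟨b', c'⟩, hbc', heq⟩ := Multiset.mem_map.1 hbc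
  cases heq
  exact hval b' c' hbc'

theorem locPred_extendAssign (hO : O.IsOccNet) (hO' : (O.addEvent Q g w).IsOccNet)
    {σ : Var → Color} {ι : O.Assign} {e : O.Trans} (h : O.locPred e ι) :
    (O.addEvent Q g w).locPred (some e) (extendAssign Q g w σ ι) := by
  refine ⟨h.1, ?_⟩
  rintro ⟨b | i, v⟩ hbv
  · rw [valOf_extendAssign hO hO']
    exact h.2 (b, v) (inl_mem_preFlow_some.1 hbv)
  · exact absurd hbv inr_not_mem_preFlow

theorem exists_pred_addEvent (hO : O.IsOccNet) (hO' : (O.addEvent Q g w).IsOccNet)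
    (hsat : ∀ e, ∃ ι, O.pred e ι) {C : Set O.Trans} (hC : O.IsConfig C)
    (hcut : ∀ bv ∈ Q, bv.1 ∈ O.cut C) {ι : O.Assign} (hι : O.IsInst C ι) {σ : Var → Color}
    (hg : g σ) (hval : ∀ bv ∈ Q, σ bv.2 = O.valOf ι bv.1) (e : (O.addEvent Q g w).Trans) :
    ∃ ι', (O.addEvent Q g w).pred e ι' := by
  rcases e with _ | e
  · refine ⟨extendAssign Q g w σ ι, predBot_extendAssign hι.1, fun e' he' => ?_⟩
    rcases evLE_none he' with rfl | ⟨e₀, rfl, bv, hbv, hle⟩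
    · refine ⟨hg, ?_⟩
      rintro ⟨b | i, v⟩ hbv
      · rw [valOf_extendAssign hO hO']
        exact hval (b, v) (inl_mem_preFlow_none.1 hbv)
      · exact absurd hbv inr_not_mem_preFlow
    · exact locPred_extendAssign hO hO'
        ((hι.2 e₀ (mem_of_cle_cut hO hC (hcut bv hbv) hle)).2 e₀ .refl)
  · obtain ⟨ι₀, hbot, hloc⟩ := hsat e
    refine ⟨extendAssign Q g w σ ι₀, predBot_extendAssign hbot, fun e' he' => ?_⟩
    obtain ⟨e₀, rfl, hle⟩ := evLE_some he'
    exact locPred_extendAssign hO hO' (hloc e₀ hle)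

end AddEvent

/-- The extension of a homomorphism `h : O → N` to the net obtained from `O` by adding an
event mapped to the transition `t`. -/
def Hom.addEvent {O N : HLNet Color Var} (h : Hom O N) (t : N.Trans)
    (Q : Multiset (O.Place × Var))
    (hQ : N.preFlow t = Q.map fun bv => (h.mapP bv.1, bv.2)) :
    Hom (O.addEvent Q (N.guard t) fun i : (N.postFlow t).ToType => i.1.2) N where
  mapP := Sum.elim h.mapP fun i => i.1.1
  mapT e := e.elim t h.mapT
  guard_iff e σ := by
    rcases e with _ | e
    · exact Iff.rfl
    · exact h.guard_iff e σ
  pre_eq e := by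
    rcases e with _ | e
    · exact hQ.trans (Multiset.map_eq_map_map (g := Prod.map Sum.inl id) fun _ => rfl)
    · exact (h.pre_eq e).trans (Multiset.map_eq_map_map (g := Prod.map Sum.inl id) fun _ => rfl)
  post_eq e := by
    rcases e with _ | e
    · exact (Multiset.map_univ_coe (N.postFlow t)).symm.trans
        (Multiset.map_eq_map_map (g := fun i : (N.postFlow t).ToType => (Sum.inr i, i.1.2))
          fun _ => rfl)
    · exact (h.post_eq e).trans (Multiset.map_eq_map_map (g := Prod.map Sum.inl id) fun _ => rfl)

/-- A symbolic branching process can be extended by an event for every transition whose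
preset is matched, in some mode, by conditions of an instantiated cut. -/
theorem isSBP_addEvent {O N : HLNet Color Var} {h : Hom O N} (hO : IsSBP h) {t : N.Trans}
    {Q : Multiset (O.Place × Var)}
    (hQt : N.preFlow t = Q.map fun bv => (h.mapP bv.1, bv.2))
    {C : Set O.Trans} (hC : O.IsConfig C) {ι : O.Assign} (hι : O.IsInst C ι)
    (hcut : ∀ bv ∈ Q, bv.1 ∈ O.cut C) (hQ : ∀ b, (Q.filter fun bv => bv.1 = b).card ≤ 1)
    {σ : Var → Color} (hg : N.guard t σ) (hval : ∀ bv ∈ Q, σ bv.2 = O.valOf ι bv.1)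
    (hnew : ∀ e, h.mapT e = t → O.preFlow e ≠ Q) : IsSBP (h.addEvent t Q hQt) := by
  obtain ⟨hocc, hinit, hsat, hinj⟩ := hO
  have hocc' := isOccNet_addEvent (g := N.guard t)
    (w := fun i : (N.postFlow t).ToType => i.1.2) hocc hC hcut hQ
  have hpinj : Function.Injective (Multiset.map
      (Prod.map (Sum.inl : O.Place → O.Place ⊕ (N.postFlow t).ToType) (id : Var → Var))) :=
    Multiset.map_injective (Sum.inl_injective.prodMap Function.injective_id)
  refine ⟨hocc', ?_, exists_pred_addEvent hocc hocc' hsat hC hcut hι hg hval, ?_⟩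
  · have hmap : (h.addEvent t Q hQt).mapMarking ''
        ((addEventIncl O Q (N.guard t) fun i : (N.postFlow t).ToType => i.1.2).mapMarking ''
          O.init) = h.mapMarking '' O.init := by
      rw [Set.image_image]
      refine Set.image_congr fun M _ => ?_
      exact Multiset.map_map _ _ _
    rw [addEventIncl_initial, hinit] at hmap
    exact hmap
  · rintro (_ | e) (_ | e') hpre hT
    · rfl
    · exact absurd (hpinj hpre).symm (hnew e' hT.symm)
    · exact absurd (hpinj hpre) (hnew e hT)
    · exact congrArg some (hinj e e' (hpinj hpre) hT)

/-- Maximality of the unfolding: a transition whose preset is matched, in some mode, by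
conditions of an instantiated cut labels an event with exactly these conditions as preset. -/
theorem IsUnfolding.exists_event {U N : HLNet Color Var} {π : Hom U N} (hU : IsUnfolding π)
    {t : N.Trans} {Q : Multiset (U.Place × Var)}
    (hQt : N.preFlow t = Q.map fun bv => (π.mapP bv.1, bv.2))
    {C : Set U.Trans} (hC : U.IsConfig C) {ι : U.Assign} (hι : U.IsInst C ι)
    (hcut : ∀ bv ∈ Q, bv.1 ∈ U.cut C) (hQ : ∀ b, (Q.filter fun bv => bv.1 = b).card ≤ 1)
    {σ : Var → Color} (hg : N.guard t σ) (hval : ∀ bv ∈ Q, σ bv.2 = U.valOf ι bv.1) :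
    ∃ e, π.mapT e = t ∧ U.preFlow e = Q := by
  by_contra! hnew
  obtain ⟨φ, hφ, hφP, _, _, hφT'⟩ :=
    hU.2 _ _ (isSBP_addEvent hU.1 hQt hC hι hcut hQ hg hval hnew)
  set incl := addEventIncl U Q (N.guard t) fun i : (N.postFlow t).ToType => i.1.2
  set ψ : Hom U U := φ.comp incl
  have hψT : ∀ e, π.mapT (ψ.mapT e) = π.mapT e := fun e => hφT' (some e)
  obtain ⟨n, hn, hfix⟩ := Function.exists_common_period (f := ψ.mapP) Q Prod.fst fun bv _ =>
    mem_periodicPts_of_endomorphism hU.1 (hφ.comp addEventIncl_initial)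
      (hφP.comp Sum.inl_injective) hψT bv.1
  obtain ⟨m, rfl⟩ := Nat.exists_eq_add_of_lt hn
  rw [zero_add] at hfix
  have hlabel : ∀ k e, π.mapT (ψ.mapT^[k] e) = π.mapT e := by
    intro k
    induction k with
    | zero => simp
    | succ k ih => intro e; rw [Function.iterate_succ_apply, ih, hψT]
  refine hnew (ψ.mapT^[m] (φ.mapT none)) ((hlabel m _).trans (hφT' none)) ?_
  rw [ψ.preFlow_iterate]
  have hpre : U.preFlow (φ.mapT none) = Q.map fun bv => (φ.mapP (Sum.inl bv.1), bv.2) :=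
    (φ.pre_eq none).trans (Multiset.map_map _ _ _)
  rw [hpre, Multiset.map_map]
  conv_rhs => rw [← Multiset.map_id Q]
  refine Multiset.map_congr rfl fun bv hbv => Prod.ext ?_ rfl
  exact (Function.iterate_succ_apply ψ.mapP m bv.1).symm.trans (hfix bv hbv)

end HLNet

/-- Let `N = (P,T,F,g,ℳ0)` be a high-level Petri net with symbolic
unfolding `Υ = (U, π)`, where `U` has events `E`. For every configuration `C` of `Υ`,
every instantiation `ι ∈ I(C)`, every transition `t ∈ T`, and every mode `σ` of `t`:
the transition `t` can fire in mode `σ` from the marking `Mark(C,ι)` if and only if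
there exists an event `e ∈ E` with `π(e) = t` such that `e` can fire in mode `σ`
from the cut `Cut(C,ι)`. -/
theorem mark_fires_iff_exists_event_fires {Color Var : Type} (N U : HLNet Color Var)
    (π : HLNet.Hom U N) (hU : HLNet.IsUnfolding π)
    (C : Set U.Trans) (hC : U.IsConfig C) (ι : U.Assign) (hι : U.IsInst C ι)
    (hfin : (U.cut C).Finite) (t : N.Trans) (σ : Var → Color) (hσ : N.guard t σ) :
    N.fires (HLNet.mark π hfin ι) t σ ↔
      ∃ e : U.Trans, π.mapT e = t ∧ U.fires (U.cutMark hfin ι) e σ := by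
  constructor
  · rintro ⟨-, hle⟩
    obtain ⟨P, hP, hPcut, hPeq⟩ := Multiset.exists_matching_of_map_le_map hle
    have hcut : ∀ p ∈ P, p.2 ∈ U.cut C := fun p hp => by
      simpa using Multiset.mem_of_le hPcut (Multiset.mem_map_of_mem Prod.snd hp)
    have hPval : ∀ p ∈ P, σ p.1.2 = U.valOf ι p.2 := fun p hp => (Prod.ext_iff.1 (hPeq p hp)).2
    have hnodup : (P.map Prod.snd).Nodup := Multiset.nodup_of_le hPcut hfin.toFinset.nodup
    obtain ⟨e, he, hpre⟩ := hU.exists_event (t := t) (Q := P.map fun p => (p.2, p.1.2)) (by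
        rw [← hP, Multiset.map_map]
        exact Multiset.map_congr rfl fun p hp => Prod.ext (Prod.ext_iff.1 (hPeq p hp)).1 rfl)
      hC hι (by
        intro bv hbv
        obtain ⟨p, hp, rfl⟩ := Multiset.mem_map.1 hbv
        exact hcut p hp) (fun b => by
        have := Multiset.nodup_iff_count_le_one.1 hnodup b
        rw [Multiset.count_map] at this
        rw [Multiset.filter_map, Multiset.card_map]
        simpa only [Function.comp_def, eq_comm] using this)
      hσ (by
        intro bv hbv
        obtain ⟨p, hp, rfl⟩ := Multiset.mem_map.1 hbv
        exact hPval p hp)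
    refine ⟨e, he, (π.guard_iff e σ).2 (he ▸ hσ), ?_⟩
    have hmark : U.preMark e σ = (P.map Prod.snd).map fun b => (b, U.valOf ι b) := by
      rw [HLNet.preMark, hpre, Multiset.map_map, Multiset.map_map]
      exact Multiset.map_congr rfl fun p hp => Prod.ext rfl (hPval p hp)
    rw [hmark]
    exact Multiset.map_le_map hPcut
  · rintro ⟨e, rfl, -, hle⟩
    refine ⟨hσ, ?_⟩
    have := Multiset.map_le_map (f := fun bc : U.Place × Color => (π.mapP bc.1, bc.2)) hle
    simpa [HLNet.preMark, HLNet.cutMark, HLNet.mark, π.pre_eq, Multiset.map_map] using this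
end
end

section
/- Let N be a finite safe high-level Petri net with exactly n reachable markings (n = |R(N)|), and let Υ be its symbolic unfolding. Then every chain of events e1 < e2 < … < e_n < e_{n+1} in Υ contains an event e_i with i > 1 such that Marks([e_i]) ⊆ ⋃_{j=1}^{i-1} Marks([e_j]), where [e] = { e' : e' ≤ e } is the cone configuration of e. -/
/-
Core formalization of high-level Petri nets, symbolic unfoldings,
branching processes, configurations, adequate orders, cut-off events,
expansions and constraints, following Würdemann–Chatain–Haar–Panneke,
"Taking Complete Finite Prefixes To High Level, Symbolically".
-/

noncomputable section
open scoped Classical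

namespace HLNet

variable {Color Var : Type} {N O : HLNet Color Var}

theorem Ordinary.nodup_pre (hO : O.Ordinary) (e : O.Trans) :
    ((O.preFlow e).map Prod.fst).Nodup := by
  rw [Multiset.nodup_iff_count_le_one]
  intro b
  rw [Multiset.count_map]
  simpa only [eq_comm] using hO.1 e b

theorem Ordinary.nodup_post (hO : O.Ordinary) (e : O.Trans) :
    ((O.postFlow e).map Prod.fst).Nodup := by
  rw [Multiset.nodup_iff_count_le_one]
  intro b
  rw [Multiset.count_map]
  simpa only [eq_comm] using hO.2 e b

theorem mem_B0_iff {b : O.Place} :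
    b ∈ O.B0 ↔ ∀ (e : O.Trans) (v : Var), (b, v) ∉ O.postFlow e := by
  simp [B0, condPre]

theorem IsOccNet.post_unique (hO : O.IsOccNet) {b : O.Place} {e e' : O.Trans} {v v' : Var}
    (hb : (b, v) ∈ O.postFlow e) (hb' : (b, v') ∈ O.postFlow e') : e' = e ∧ v' = v := by
  obtain h | ⟨⟨e₀, v₀, -, h⟩, -⟩ := hO.2.2.2.2.2 b
  · exact absurd hb (h.1 e v)
  · obtain ⟨rfl, rfl⟩ := h e v hb
    exact h e' v' hb'

theorem IsOccNet.condPre_eq (hO : O.IsOccNet) {b : O.Place} {e : O.Trans} {v : Var}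
    (hb : (b, v) ∈ O.postFlow e) : O.condPre b = some (e, v) := by
  have hex : ∃ ev : O.Trans × Var, (b, ev.2) ∈ O.postFlow ev.1 := ⟨(e, v), hb⟩
  rw [condPre, dif_pos hex, Option.some_inj]
  exact Prod.ext_iff.2 (hO.post_unique hb hex.choose_spec)

theorem IsOccNet.init_map_fst_nodup (hO : O.IsOccNet) {K : O.Marking} (hK : K ∈ O.init) :
    (K.map Prod.fst).Nodup := by
  rw [Multiset.nodup_iff_count_le_one]
  intro b
  rw [Multiset.count_map]
  have : (K.filter fun bc => bc.1 = b).card ≤ 1 := by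
    obtain h | h := hO.2.2.2.2.2 b
    · exact (h.2 K hK).le
    · exact (h.2 K hK).trans_le zero_le_one
  simpa only [eq_comm] using this

theorem IsOccNet.mem_init_map_fst (hO : O.IsOccNet) {K : O.Marking} (hK : K ∈ O.init)
    {b : O.Place} : b ∈ K.map Prod.fst ↔ b ∈ O.B0 := by
  have hcard : b ∈ K.map Prod.fst ↔ (K.filter fun bc => bc.1 = b).card ≠ 0 := by
    simp [Multiset.filter_eq_nil]
  rw [hcard, mem_B0_iff]
  obtain h | ⟨⟨e, v, hb, -⟩, h⟩ := hO.2.2.2.2.2 b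
  · simp [h.1, h.2 K hK]
  · exact iff_of_false (not_not_intro (h K hK)) fun h' => h' e v hb

theorem IsOccNet.finite_B0 (hO : O.IsOccNet) : O.B0.Finite := by
  obtain ⟨K, hK⟩ := hO.1.1
  exact (K.map Prod.fst).toFinset.finite_toSet.subset fun b hb =>
    Multiset.mem_toFinset.2 ((hO.mem_init_map_fst hK).2 hb)

theorem IsOccNet.finite_cut (hO : O.IsOccNet) {C : Set O.Trans} (hC : C.Finite) :
    (O.cut C).Finite := by
  refine Set.Finite.subset (hO.finite_B0.union (hC.biUnion fun e _ =>
    ((O.postFlow e).map Prod.fst).toFinset.finite_toSet)) ?_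
  rintro b ⟨hb | ⟨e, he, v, hb⟩, -⟩
  · exact Or.inl hb
  · refine Or.inr (Set.mem_biUnion he ?_)
    simpa using ⟨v, hb⟩

/-- The causal predecessors of a node are finite in number: presets are finite and
causality is well-founded. -/
theorem IsOccNet.finite_cle (hO : O.IsOccNet) (x : O.Node) : {y | O.cle y x}.Finite := by
  induction x using hO.2.2.2.2.1.induction with
  | _ x ih =>
    have hpre : {y | O.arc y x}.Finite := by
      cases x with
      | inl b =>
        refine Set.Subsingleton.finite ?_
        rintro (c | e) hc (c' | e') hc'
        · exact hc.elim
        · exact hc.elim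
        · exact hc'.elim
        · obtain ⟨v, hv⟩ := hc
          obtain ⟨v', hv'⟩ := hc'
          exact congrArg _ (hO.post_unique hv' hv).1
      | inr e =>
        refine ((O.preFlow e).map fun bv => (Sum.inl bv.1 : O.Node)).toFinset.finite_toSet.subset ?_
        rintro (c | e') hc
        · obtain ⟨v, hv⟩ := hc
          simpa using ⟨v, hv⟩
        · exact hc.elim
    refine ((hpre.biUnion fun y hy => ih y (Relation.TransGen.single hy)).insert x).subset ?_
    intro y hy
    obtain rfl | ⟨z, hyz, hz⟩ := Relation.ReflTransGen.cases_tail hy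
    · exact Set.mem_insert _ _
    · exact Or.inr (Set.mem_biUnion hz hyz)

theorem IsOccNet.finite_cone (hO : O.IsOccNet) (e : O.Trans) : (O.cone e).Finite :=
  (hO.finite_cle (Sum.inr e)).preimage Sum.inr_injective.injOn

theorem SConflict.mono {x y x' y' : O.Node} (h : O.SConflict x y) (hx : O.cle x x')
    (hy : O.cle y y') : O.SConflict x' y' := by
  obtain ⟨b, t₁, t₂, hne, h₁, h₂, h₃, h₄⟩ := h
  exact ⟨b, t₁, t₂, hne, h₁, h₂, h₃.trans hx, h₄.trans hy⟩

theorem IsOccNet.isConfig_cone (hO : O.IsOccNet) {e : O.Trans} (he : ∃ ι, O.pred e ι) :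
    O.IsConfig (O.cone e) := by
  refine ⟨fun _ h₁ _ h₂ => Relation.ReflTransGen.trans h₂ h₁,
    fun _ h₁ _ h₂ hc => hO.2.2.1 e (hc.mono h₁ h₂), ?_⟩
  obtain ⟨ι, hι⟩ := he
  exact ⟨ι, hι.1, fun _ h₁ => ⟨hι.1, fun _ h₂ => hι.2 _ (Relation.ReflTransGen.trans h₂ h₁)⟩⟩

theorem exists_maximal_event (hO : O.IsOccNet) {C : Set O.Trans} (hC : C.Finite)
    (hne : C.Nonempty) : ∃ e ∈ C, ∀ e' ∈ C, ¬ O.evLT e e' := by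
  let _ : Preorder O.Trans :=
    { le := O.evLE
      le_refl := fun _ => Relation.ReflTransGen.refl
      le_trans := fun _ _ _ => Relation.ReflTransGen.trans }
  obtain ⟨e, he⟩ := hC.exists_maximal hne
  exact ⟨e, he.1, fun e' he' hlt =>
    hO.2.2.2.1 _ (hlt.trans_left (he.2 he' hlt.to_reflTransGen))⟩

theorem mark_empty_mem_init {h : Hom O N} (hO : O.IsOccNet) (hh : h.Initial) {ι : O.Assign}
    (hι : O.predBot ι) (hfin : (O.cut ∅).Finite) : mark h hfin ι ∈ N.init := by
  obtain ⟨K, hK, hKι⟩ := hι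
  rw [← hh]
  refine ⟨K, hK, ?_⟩
  have hcut : hfin.toFinset.val = K.map Prod.fst := by
    refine (Multiset.Nodup.ext hfin.toFinset.nodup (hO.init_map_fst_nodup hK)).2 fun b => ?_
    rw [hO.mem_init_map_fst hK]
    simp [cut, postConds, preConds]
  rw [mark, hcut, Multiset.map_map]
  refine Multiset.map_congr rfl fun bc hbc => ?_
  have hb : O.condPre bc.1 = none :=
    (hO.mem_init_map_fst hK).1 (Multiset.mem_map_of_mem Prod.fst hbc)
  simp [valOf, hb, hKι bc.1 bc.2 hbc]

theorem preMark_mapT (h : Hom O N) {e : O.Trans} {ι : O.Assign} (he : O.locPred e ι) :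
    N.preMark (h.mapT e) (fun v => ι (Sum.inl (e, v))) =
      ((O.preFlow e).map Prod.fst).map fun b => (h.mapP b, O.valOf ι b) := by
  rw [preMark, h.pre_eq, Multiset.map_map, Multiset.map_map]
  refine Multiset.map_congr rfl fun bv hbv => ?_
  simp [he.2 bv hbv]

theorem postMark_mapT (h : Hom O N) (hO : O.IsOccNet) (e : O.Trans) (ι : O.Assign) :
    N.postMark (h.mapT e) (fun v => ι (Sum.inl (e, v))) =
      ((O.postFlow e).map Prod.fst).map fun b => (h.mapP b, O.valOf ι b) := by
  rw [postMark, h.post_eq, Multiset.map_map, Multiset.map_map]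
  refine Multiset.map_congr rfl fun bv hbv => ?_
  simp [valOf, hO.condPre_eq (b := bv.1) (v := bv.2) hbv]

theorem arc_pre {b : O.Place} {v : Var} {e : O.Trans} (hb : (b, v) ∈ O.preFlow e) :
    O.arc (Sum.inl b) (Sum.inr e) := ⟨v, hb⟩

theorem arc_post {b : O.Place} {v : Var} {e : O.Trans} (hb : (b, v) ∈ O.postFlow e) :
    O.arc (Sum.inr e) (Sum.inl b) := ⟨v, hb⟩

theorem evLT_of_mem_post_of_mem_pre {b : O.Place} {v v' : Var} {e e' : O.Trans}
    (hb : (b, v) ∈ O.postFlow e) (hb' : (b, v') ∈ O.preFlow e') : O.evLT e e' :=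
  (Relation.TransGen.single (arc_post hb)).tail (arc_pre hb')

theorem IsConfig.diff_singleton {C : Set O.Trans} (hC : O.IsConfig C) {e : O.Trans}
    (hmax : ∀ e' ∈ C, ¬ O.evLT e e') : O.IsConfig (C \ {e}) := by
  refine ⟨fun e₁ h₁ e₂ h₂ => ⟨hC.1 e₁ h₁.1 e₂ h₂, ?_⟩,
    fun e₁ h₁ e₂ h₂ => hC.2.1 e₁ h₁.1 e₂ h₂.1, ?_⟩
  · rintro rfl
    obtain h | h := Relation.reflTransGen_iff_eq_or_transGen.1 h₂
    · exact h₁.2 (Sum.inr_injective h)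
    · exact hmax e₁ h₁.1 h
  · obtain ⟨ι, hι⟩ := hC.2.2
    exact ⟨ι, hι.1, fun e₁ h₁ => hι.2 e₁ h₁.1⟩

theorem pre_mem_cut_diff (hO : O.IsOccNet) {C : Set O.Trans} (hC : O.IsConfig C) {e : O.Trans}
    (he : e ∈ C) {b : O.Place} {v : Var} (hb : (b, v) ∈ O.preFlow e) :
    b ∈ O.cut (C \ {e}) := by
  constructor
  · by_cases hB : b ∈ O.B0
    · exact Or.inl hB
    · rw [mem_B0_iff] at hB
      push Not at hB
      obtain ⟨e', v', hb'⟩ := hB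
      have hlt : O.evLT e' e := evLT_of_mem_post_of_mem_pre hb' hb
      refine Or.inr ⟨e', ⟨hC.1 e he e' hlt.to_reflTransGen, ?_⟩, v', hb'⟩
      rintro rfl
      exact hO.2.2.2.1 _ hlt
  · rintro ⟨e', he', v', hb'⟩
    exact hC.2.1 e he e' he'.1 ⟨b, e, e', Ne.symm he'.2, ⟨v, hb⟩, ⟨v', hb'⟩,
      Relation.ReflTransGen.refl, Relation.ReflTransGen.refl⟩

theorem post_notMem_cut_diff (hO : O.IsOccNet) {C : Set O.Trans} {e : O.Trans}
    {b : O.Place} {v : Var} (hb : (b, v) ∈ O.postFlow e) : b ∉ O.cut (C \ {e}) := by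
  rintro ⟨hB | ⟨e', he', v', hb'⟩, -⟩
  · exact mem_B0_iff.1 hB e v hb
  · exact he'.2 (hO.post_unique hb hb').1

theorem mem_cut_iff_of_maximal {C : Set O.Trans}
    {e : O.Trans} (he : e ∈ C) (hmax : ∀ e' ∈ C, ¬ O.evLT e e') {b : O.Place} :
    b ∈ O.cut C ↔
      (b ∈ O.cut (C \ {e}) ∧ ∀ v, (b, v) ∉ O.preFlow e) ∨ ∃ v, (b, v) ∈ O.postFlow e := by
  constructor
  · rintro ⟨hb, hpre⟩
    by_cases hpost : ∃ v, (b, v) ∈ O.postFlow e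
    · exact Or.inr hpost
    · refine Or.inl ⟨⟨hb.imp_right ?_, ?_⟩, fun v hv => hpre ⟨e, he, v, hv⟩⟩
      · rintro ⟨e', he', v, hv⟩
        refine ⟨e', ⟨he', ?_⟩, v, hv⟩
        rintro rfl
        exact hpost ⟨v, hv⟩
      · rintro ⟨e', he', hv⟩
        exact hpre ⟨e', he'.1, hv⟩
  · rintro (⟨⟨hb, hpre⟩, hne⟩ | ⟨v, hv⟩)
    · refine ⟨hb.imp_right ?_, ?_⟩
      · rintro ⟨e', he', hv⟩
        exact ⟨e', he'.1, hv⟩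
      · rintro ⟨e', he', v, hv⟩
        by_cases hee : e' = e
        · subst hee
          exact hne v hv
        · exact hpre ⟨e', ⟨he', hee⟩, v, hv⟩
    · refine ⟨Or.inr ⟨e, he, v, hv⟩, ?_⟩
      rintro ⟨e', he', v', hpre⟩
      exact hmax e' he' (evLT_of_mem_post_of_mem_pre hv hpre)

/-- Adding a maximal event to an instantiated configuration fires its label in `N`. -/
theorem firesTo_mark (h : Hom O N) (hO : O.IsOccNet) {C : Set O.Trans} (hC : O.IsConfig C)
    {e : O.Trans} (he : e ∈ C) (hmax : ∀ e' ∈ C, ¬ O.evLT e e') {ι : O.Assign}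
    (hι : O.IsInst C ι) (hfin : (O.cut C).Finite) (hfin' : (O.cut (C \ {e})).Finite) :
    N.firesTo (mark h hfin' ι) (h.mapT e) (fun v => ι (Sum.inl (e, v))) (mark h hfin ι) := by
  have hloc : O.locPred e ι := (hι.2 e he).2 e Relation.ReflTransGen.refl
  let P : Finset O.Place := ⟨_, hO.2.1.nodup_pre e⟩
  let Q : Finset O.Place := ⟨_, hO.2.1.nodup_post e⟩
  have hP {b : O.Place} : b ∈ P ↔ ∃ v, (b, v) ∈ O.preFlow e := by
    simp [P, ← Finset.mem_val]
  have hQ {b : O.Place} : b ∈ Q ↔ ∃ v, (b, v) ∈ O.postFlow e := by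
    simp [Q, ← Finset.mem_val]
  have hle : P ⊆ hfin'.toFinset := fun b hb => by
    obtain ⟨v, hv⟩ := hP.1 hb
    exact hfin'.mem_toFinset.2 (pre_mem_cut_diff hO hC he hv)
  have hdisj : Disjoint (hfin'.toFinset \ P) Q := by
    refine Finset.disjoint_left.2 fun b hb hb' => ?_
    obtain ⟨v, hv⟩ := hQ.1 hb'
    exact post_notMem_cut_diff hO hv (hfin'.mem_toFinset.1 (Finset.mem_sdiff.1 hb).1)
  have hcut : hfin.toFinset = (hfin'.toFinset \ P).disjUnion Q hdisj := by
    ext b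
    simp [hP, hQ, mem_cut_iff_of_maximal he hmax]
  have hcut' : hfin'.toFinset = (hfin'.toFinset \ P).disjUnion P Finset.sdiff_disjoint := by
    rw [Finset.disjUnion_eq_union, Finset.sdiff_union_of_subset hle]
  have hmark : mark h hfin ι = ((hfin'.toFinset \ P).val.map fun b => (h.mapP b, O.valOf ι b)) +
      N.postMark (h.mapT e) (fun v => ι (Sum.inl (e, v))) := by
    rw [postMark_mapT h hO, mark, hcut, Finset.disjUnion_val, Multiset.map_add]
  have hmark' : mark h hfin' ι = ((hfin'.toFinset \ P).val.map fun b => (h.mapP b, O.valOf ι b)) +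
      N.preMark (h.mapT e) (fun v => ι (Sum.inl (e, v))) := by
    rw [preMark_mapT h hloc, mark, ← Multiset.map_add]
    exact congrArg (fun s : Finset O.Place => s.val.map _) hcut'
  refine ⟨⟨(h.guard_iff e _).1 hloc.1, ?_⟩, ?_⟩
  · rw [hmark']
    exact Multiset.le_add_left _ _
  · rw [hmark', add_tsub_cancel_right, hmark]

/-- Every marking represented by a finite configuration is reachable. -/
theorem reach_mark {h : Hom O N} (hO : O.IsOccNet) (hh : h.Initial) {C : Set O.Trans}
    (hfinC : C.Finite) (hC : O.IsConfig C) {ι : O.Assign} (hι : O.IsInst C ι)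
    (hfin : (O.cut C).Finite) : N.Reach (mark h hfin ι) := by
  induction hn : C.ncard generalizing C with
  | zero =>
    obtain rfl := (Set.ncard_eq_zero hfinC).1 hn
    exact Reach.init (mark_empty_mem_init hO hh hι.1 hfin)
  | succ n ih =>
    obtain ⟨e, he, hmax⟩ := exists_maximal_event hO hfinC
      (Set.nonempty_of_ncard_ne_zero (hn ▸ n.succ_ne_zero))
    have hfinC' : (C \ {e}).Finite := hfinC.sdiff
    refine Reach.step (ih hfinC' (hC.diff_singleton hmax)
      ⟨hι.1, fun e₁ h₁ => hι.2 e₁ h₁.1⟩ (hO.finite_cut hfinC') ?_)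
      (firesTo_mark h hO hC he hmax hι hfin (hO.finite_cut hfinC'))
    rw [Set.ncard_sdiff_singleton_of_mem he, hn, Nat.add_sub_cancel]

theorem IsSBP.reach_of_mem_marks_cone {h : Hom O N} (hS : IsSBP h) (e : O.Trans) {M : N.Marking}
    (hM : M ∈ marks h (O.cone e)) : N.Reach M := by
  obtain ⟨ι, hι, hfin, rfl⟩ := hM
  exact reach_mark hS.1 hS.2.1 (hS.1.finite_cone e) (hS.1.isConfig_cone (hS.2.2.1 e)) hι hfin

theorem IsSBP.marks_cone_nonempty {h : Hom O N} (hS : IsSBP h) (e : O.Trans) :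
    (marks h (O.cone e)).Nonempty := by
  obtain ⟨ι, hι⟩ := (hS.1.isConfig_cone (hS.2.2.1 e)).2.2
  exact ⟨_, ι, hι, hS.1.finite_cut (hS.1.finite_cone e), rfl⟩

end HLNet

/-- Let `N` be a finite safe high-level Petri net with exactly `n`
reachable markings (`n = |R(N)|`), and let `Υ = (O, h)` be its symbolic unfolding.
Then every chain of events `e1 < e2 < … < e_n < e_{n+1}` in `Υ` contains an event
`e_i` with `i > 1` such that `Marks([e_i]) ⊆ ⋃_{j=1}^{i-1} Marks([e_j])`, where
`[e] = { e' : e' ≤ e }` is the cone configuration of `e`. -/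
theorem chain_contains_event_with_covered_marks {Color Var : Type}
    (N O : HLNet Color Var) (h : HLNet.Hom O N)
    (hfinN : N.NetFinite) (hsafe : N.Safe) (hU : HLNet.IsUnfolding h)
    (n : ℕ) (hRfin : {M | N.Reach M}.Finite) (hn : {M | N.Reach M}.ncard = n)
    (e : Fin (n + 1) → O.Trans) (hchain : ∀ i j, i < j → O.evLT (e i) (e j)) :
    ∃ i : Fin (n + 1), 0 < (i : ℕ) ∧
      ∀ M ∈ HLNet.marks h (O.cone (e i)),
        ∃ j : Fin (n + 1), j < i ∧ M ∈ HLNet.marks h (O.cone (e j)) := by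
  by_contra hcon
  push Not at hcon
  have hS := hU.1
  have hnew : ∀ i, ∃ M ∈ HLNet.marks h (O.cone (e i)),
      ∀ j < i, M ∉ HLNet.marks h (O.cone (e j)) := fun i => by
    rcases Nat.eq_zero_or_pos (i : ℕ) with hi | hi
    · obtain ⟨M, hM⟩ := hS.marks_cone_nonempty (e i)
      exact ⟨M, hM, fun j hj => absurd hj (by simp [Fin.lt_def, hi])⟩
    · exact hcon i hi
  choose f hf hf' using hnew
  have hinj : Function.Injective f :=
    .of_lt_imp_ne fun i j hij heq => hf' j i hij (heq ▸ hf i)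
  have hcard : (Set.range f).ncard ≤ {M | N.Reach M}.ncard :=
    Set.ncard_le_ncard
      (Set.range_subset_iff.2 fun i => hS.reach_of_mem_marks_cone (e i) (hf i)) hRfin
  rw [hn, ← Set.image_univ, Set.ncard_image_of_injective _ hinj, Set.ncard_univ,
    Nat.card_fin] at hcard
  omega
end
end
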